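/- Let T be a nondegenerate tetrahedron and define P₃⁻(T) = P₂(T) + span{λ₁²λ₂, λ₂²λ₃, λ₃²λ₁}. Then dim P₃⁻(T) = 13, and any v ∈ P₃⁻(T) is uniquely determined by the 13 functionals: ∫_F v q ds for all q ∈ P₁(F) on each of the four faces F of T (12 functionals), together with ∫_T v dx. -/

import Mathlib

open MeasureTheory MvPolynomial
open scoped RealInnerProductSpace

noncomputable section

/-- Euclidean 3-space. -/
abbrev E3 := EuclideanSpace ℝ (Fin 3)

/-- Evaluate a polynomial in 3 variables at a point of `E3`. -/
def evalP (x : E3) (p : MvPolynomial (Fin 3) ℝ) : ℝ :=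
  MvPolynomial.eval (fun j => x j) p

/-- The (closed) facet of the tetrahedron opposite to vertex `i`. -/
def face (a : Fin 4 → E3) (i : Fin 4) : Set E3 :=
  convexHull ℝ (a '' {j | j ≠ i})

/-- The (closed) tetrahedron with vertices `a`. -/
def tetra (a : Fin 4 → E3) : Set E3 :=
  convexHull ℝ (Set.range a)

/-- The reduced cubic space `P₃⁻(T) = P₂(T) + span{λ₁²λ₂, λ₂²λ₃, λ₃²λ₁}`
(vertex indices `0,1,2,3`). -/
def P3minus (lam : Fin 4 → MvPolynomial (Fin 3) ℝ) : Set (MvPolynomial (Fin 3) ℝ) :=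
  {w | ∃ (p : MvPolynomial (Fin 3) ℝ) (c₁ c₂ c₃ : ℝ), p.totalDegree ≤ 2 ∧
    w = p + c₁ • (lam 0 ^ 2 * lam 1) + c₂ • (lam 1 ^ 2 * lam 2) + c₃ • (lam 2 ^ 2 * lam 0)}


/-! ### Dirichlet integrals -/

lemma dir1_rec (r : ℝ) (m n : ℕ) :
    ((n : ℝ) + 1) * (∫ t in (0:ℝ)..r, t ^ n * (r - t) ^ (m + 1)) =
      ((m : ℝ) + 1) * ∫ t in (0:ℝ)..r, t ^ (n + 1) * (r - t) ^ m := by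
  have h : ∫ t in (0:ℝ)..r, (((n : ℝ) + 1) * (t ^ n * (r - t) ^ (m + 1)) -
      ((m : ℝ) + 1) * (t ^ (n + 1) * (r - t) ^ m)) = 0 := by
    have hd : ∀ t ∈ Set.uIcc (0:ℝ) r, HasDerivAt (fun t : ℝ => t ^ (n + 1) * (r - t) ^ (m + 1))
        (((n : ℝ) + 1) * (t ^ n * (r - t) ^ (m + 1)) -
      ((m : ℝ) + 1) * (t ^ (n + 1) * (r - t) ^ m)) t := by
      intro t _
      have h1 := (hasDerivAt_id t).pow (n + 1)
      have h2 := ((hasDerivAt_id t).const_sub r).pow (m + 1)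
      convert! h1.mul h2 using 1
      simp
      ring
    rw [intervalIntegral.integral_eq_sub_of_hasDerivAt hd]
    · simp
    · apply Continuous.intervalIntegrable
      fun_prop
  rw [intervalIntegral.integral_sub, intervalIntegral.integral_const_mul,
    intervalIntegral.integral_const_mul] at h
  · linarith
  · apply Continuous.intervalIntegrable
    fun_prop
  · apply Continuous.intervalIntegrable
    fun_prop

lemma dir1 (r : ℝ) (m : ℕ) : ∀ n : ℕ,
    (∫ t in (0:ℝ)..r, t ^ n * (r - t) ^ m) =
      (n.factorial * m.factorial : ℝ) / (n + m + 1).factorial * r ^ (n + m + 1) := by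
  induction m with
  | zero =>
    intro n
    have := n.factorial_ne_zero
    simp [Nat.factorial_succ]
    field_simp
  | succ m ih =>
    intro n
    have h := dir1_rec r m n
    rw [ih (n + 1)] at h
    have hn : (n : ℝ) + 1 ≠ 0 := by positivity
    apply mul_left_cancel₀ hn
    rw [h, show n + (m + 1) + 1 = n + 1 + m + 1 by ring]
    simp only [Nat.factorial_succ n, Nat.factorial_succ m]
    push_cast
    ring

lemma dir2 (r : ℝ) (k m n : ℕ) :
    (∫ s in (0:ℝ)..r, ∫ t in (0:ℝ)..(r - s), (r - s - t) ^ k * s ^ m * t ^ n) =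
      (k.factorial * m.factorial * n.factorial : ℝ) / (k + m + n + 2).factorial
        * r ^ (k + m + n + 2) := by
  have h : ∀ s : ℝ, (∫ t in (0:ℝ)..(r - s), (r - s - t) ^ k * s ^ m * t ^ n) =
      (n.factorial * k.factorial : ℝ) / (n + k + 1).factorial *
        (s ^ m * (r - s) ^ (n + k + 1)) := by
    intro s
    rw [mul_left_comm, ← dir1, ← intervalIntegral.integral_const_mul]
    congr 1
    ext t
    ring
  simp_rw [h]
  rw [intervalIntegral.integral_const_mul, dir1]
  rw [show m + (n + k + 1) + 1 = k + m + n + 2 by ring]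
  have := (n + k + 1).factorial_ne_zero
  field_simp

lemma dir3 (r : ℝ) (l k m n : ℕ) :
    (∫ q in (0:ℝ)..r, ∫ s in (0:ℝ)..(r - q), ∫ t in (0:ℝ)..(r - q - s),
        (r - q - s - t) ^ l * q ^ k * s ^ m * t ^ n) =
      (l.factorial * k.factorial * m.factorial * n.factorial : ℝ) /
        (l + k + m + n + 3).factorial * r ^ (l + k + m + n + 3) := by
  have h : ∀ q : ℝ, (∫ s in (0:ℝ)..(r - q), ∫ t in (0:ℝ)..(r - q - s),
        (r - q - s - t) ^ l * q ^ k * s ^ m * t ^ n) =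
      (l.factorial * m.factorial * n.factorial : ℝ) / (l + m + n + 2).factorial *
        (q ^ k * (r - q) ^ (l + m + n + 2)) := by
    intro q
    rw [mul_left_comm, ← dir2, ← intervalIntegral.integral_const_mul]
    congr 1
    ext s
    rw [← intervalIntegral.integral_const_mul]
    congr 1
    ext t
    ring
  simp_rw [h]
  rw [intervalIntegral.integral_const_mul, dir1]
  rw [show k + (l + m + n + 2) + 1 = l + k + m + n + 3 by ring]
  have := (l + m + n + 2).factorial_ne_zero
  field_simp

/-! ### Simplices as iterated integrals -/

def K2 (r : ℝ) : Set (ℝ × ℝ) := {p | 0 ≤ p.1 ∧ 0 ≤ p.2 ∧ p.1 + p.2 ≤ r}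

def K3 : Set (ℝ × ℝ × ℝ) := {p | 0 ≤ p.1 ∧ 0 ≤ p.2.1 ∧ 0 ≤ p.2.2 ∧ p.1 + p.2.1 + p.2.2 ≤ 1}

lemma isCompact_K2 (r : ℝ) : IsCompact (K2 r) := by
  apply IsCompact.of_isClosed_subset (isCompact_Icc (a := ((0:ℝ), (0:ℝ))) (b := (r, r)))
  · simp only [K2, Set.ofPred_and]
    refine IsClosed.inter (isClosed_le ?_ ?_)
      (IsClosed.inter (isClosed_le ?_ ?_) (isClosed_le ?_ ?_)) <;> fun_prop
  · rintro ⟨s, t⟩ ⟨h1, h2, h3⟩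
    simp only at h1 h2 h3
    exact ⟨⟨h1, h2⟩, ⟨by simp only; linarith, by simp only; linarith⟩⟩

lemma isCompact_K3 : IsCompact K3 := by
  apply IsCompact.of_isClosed_subset
    (isCompact_Icc (a := ((0:ℝ), (0:ℝ), (0:ℝ))) (b := (1, 1, 1)))
  · simp only [K3, Set.ofPred_and]
    refine IsClosed.inter (isClosed_le ?_ ?_) (IsClosed.inter (isClosed_le ?_ ?_)
      (IsClosed.inter (isClosed_le ?_ ?_) (isClosed_le ?_ ?_))) <;> fun_prop
  · rintro ⟨q, s, t⟩ ⟨h1, h2, h3, h4⟩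
    simp only at h1 h2 h3 h4
    exact ⟨⟨h1, h2, h3⟩, ⟨by simp only; linarith, by simp only; linarith, by simp only; linarith⟩⟩

lemma integral_K2 (r : ℝ) (hr : 0 ≤ r) (f : ℝ × ℝ → ℝ) (hf : Continuous f) :
    ∫ p in K2 r, f p = ∫ s in (0:ℝ)..r, ∫ t in (0:ℝ)..(r - s), f (s, t) := by
  have hm := (isCompact_K2 r).measurableSet
  have hint : IntegrableOn f (K2 r) := hf.continuousOn.integrableOn_compact (isCompact_K2 r)
  rw [← integral_indicator hm, Measure.volume_eq_prod, integral_prod]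
  swap
  · rw [← Measure.volume_eq_prod]; exact hint.integrable_indicator hm
  rw [intervalIntegral.integral_of_le hr, ← integral_Icc_eq_integral_Ioc,
    ← integral_indicator measurableSet_Icc]
  congr 1
  ext s
  by_cases hs : s ∈ Set.Icc 0 r
  · rw [Set.indicator_of_mem hs, intervalIntegral.integral_of_le (by linarith [hs.2]),
      ← integral_Icc_eq_integral_Ioc, ← integral_indicator measurableSet_Icc]
    congr 1
    ext t
    by_cases ht : t ∈ Set.Icc 0 (r - s)
    · rw [Set.indicator_of_mem ht, Set.indicator_of_mem]
      exact ⟨hs.1, ht.1, by simp only; linarith [ht.2]⟩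
    · rw [Set.indicator_of_notMem ht, Set.indicator_of_notMem]
      rintro ⟨h1, h2, h3⟩
      simp only at h1 h2 h3
      exact ht ⟨h2, by linarith⟩
  · rw [Set.indicator_of_notMem hs]
    rw [← integral_zero ℝ ℝ]
    congr 1
    ext t
    rw [Set.indicator_of_notMem]
    rintro ⟨h1, h2, h3⟩
    simp only at h1 h2 h3
    exact hs ⟨h1, by linarith⟩

lemma integral_K3 (f : ℝ × ℝ × ℝ → ℝ) (hf : Continuous f) :
    ∫ p in K3, f p =
      ∫ q in (0:ℝ)..1, ∫ s in (0:ℝ)..(1 - q), ∫ t in (0:ℝ)..(1 - q - s), f (q, s, t) := by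
  have hm := (isCompact_K3).measurableSet
  have hint : IntegrableOn f K3 := hf.continuousOn.integrableOn_compact isCompact_K3
  rw [← integral_indicator hm, Measure.volume_eq_prod, integral_prod]
  swap
  · rw [← Measure.volume_eq_prod]; exact hint.integrable_indicator hm
  rw [intervalIntegral.integral_of_le zero_le_one, ← integral_Icc_eq_integral_Ioc,
    ← integral_indicator measurableSet_Icc]
  congr 1
  ext s
  by_cases hs : s ∈ Set.Icc (0:ℝ) 1
  · rw [Set.indicator_of_mem hs, ← integral_K2 (1 - s) (by linarith [hs.2]) (fun p => f (s, p))
      (by fun_prop), ← integral_indicator (isCompact_K2 _).measurableSet]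
    congr 1
    ext t
    by_cases ht : t ∈ K2 (1 - s)
    · rw [Set.indicator_of_mem ht, Set.indicator_of_mem]
      exact ⟨hs.1, ht.1, ht.2.1, by simp only; linarith [ht.2.2]⟩
    · rw [Set.indicator_of_notMem ht, Set.indicator_of_notMem]
      rintro ⟨h1, h2, h3, h4⟩
      simp only at h1 h2 h3 h4
      exact ht ⟨h2, h3, by linarith⟩
  · rw [Set.indicator_of_notMem hs]
    rw [← integral_zero (ℝ × ℝ) ℝ]
    congr 1
    ext t
    rw [Set.indicator_of_notMem]
    rintro ⟨h1, h2, h3, h4⟩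
    simp only at h1 h2 h3 h4
    exact hs ⟨h1, by linarith⟩

/-! ### Change of variables -/

lemma integral_affine {X : Type*} [NormedAddCommGroup X] [NormedSpace ℝ X]
    [FiniteDimensional ℝ X] [MeasureSpace X] [BorelSpace X]
    [(volume : Measure X).IsAddHaarMeasure]
    (L : X →L[ℝ] E3) (hL : Function.Injective L) (μ : Measure E3) [μ.IsAddLeftInvariant]
    (hfin : ∀ K : Set X, IsCompact K → μ (L '' K) < ⊤) (h0 : μ (L '' Set.univ) ≠ 0) :
    ∃ C : ℝ, C ≠ 0 ∧ ∀ (b : E3) (K : Set X) (f : E3 → ℝ),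
      ∫ x in (fun p => b + L p) '' K, f x ∂μ = C * ∫ p in K, f (b + L p) := by
  have : SecondCountableTopology X := by
    have := FiniteDimensional.proper_real X
    infer_instance
  have hcl : Topology.IsClosedEmbedding L :=
    LinearMap.isClosedEmbedding_of_injective (f := (L : X →ₗ[ℝ] E3)) (LinearMap.ker_eq_bot.2 hL)
  have hme : MeasurableEmbedding L := hcl.measurableEmbedding
  have := FiniteDimensional.proper_real X
  let ν := μ.comap L
  have hν : ν.IsAddLeftInvariant := Measure.IsAddLeftInvariant.comap μ (f := (L : X →+ E3)) hme
  have hνf : IsFiniteMeasureOnCompacts ν := ⟨fun K hK => by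
    rw [hme.comap_apply]; exact hfin K hK⟩
  have heq := Measure.isAddLeftInvariant_eq_smul ν volume
  set c := Measure.addHaarScalarFactor ν volume with hc
  have hc0 : c ≠ 0 := by
    intro h
    rw [h, zero_smul] at heq
    apply h0
    rw [← hme.comap_apply]
    change ν _ = 0
    rw [heq]; simp
  refine ⟨c, by exact_mod_cast hc0, ?_⟩
  intro b K f
  have e1 : (fun p => b + L p) '' K = (fun y => (-b) + y) ⁻¹' (L '' K) := by
    ext x
    constructor
    · rintro ⟨p, hp, rfl⟩
      exact ⟨p, hp, by simp⟩
    · rintro ⟨p, hp, h⟩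
      exact ⟨p, hp, by simp [h]⟩
  have e2 : ∫ x in (fun p => b + L p) '' K, f x ∂μ = ∫ y in L '' K, f (b + y) ∂μ := by
    rw [e1]
    have := (measurePreserving_add_left μ (-b)).setIntegral_preimage_emb
      (measurableEmbedding_addLeft (-b)) (fun y => f (b + y)) (L '' K)
    rw [← this]
    simp
  rw [e2]
  have e3 : ∫ y in L '' K, f (b + y) ∂μ = ∫ y in L '' K, f (b + y) ∂(ν.map L) := by
    rw [hme.map_comap, Measure.restrict_restrict_of_subset (Set.image_subset_range _ _)]
  rw [e3, hme.setIntegral_map, Set.preimage_image_eq _ hL, heq, Measure.restrict_smul,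
    integral_smul_nnreal_measure]
  rfl

/-! ### Polynomials -/

lemma mem_pow_of_totalDegree (V : Submodule ℝ (MvPolynomial (Fin 3) ℝ))
    (h1 : (1 : MvPolynomial (Fin 3) ℝ) ∈ V) (hX : ∀ i, (X i : MvPolynomial (Fin 3) ℝ) ∈ V)
    (n : ℕ) (p : MvPolynomial (Fin 3) ℝ) (hp : p.totalDegree ≤ n) : p ∈ V ^ n := by
  have hmono : ∀ m, m ≤ n → V ^ m ≤ V ^ n := fun m hm =>
    pow_le_pow_right₀ (Submodule.one_le.2 h1) hm
  rw [p.as_sum]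
  refine Submodule.sum_mem _ fun s hs => ?_
  have hsd := (le_totalDegree hs).trans hp
  rw [monomial_eq, ← smul_eq_C_mul]
  refine Submodule.smul_mem _ _ ?_
  apply hmono _ hsd
  rw [Finsupp.prod_fintype _ _ (by simp), Finsupp.sum_fintype _ _ (by simp),
    ← Finset.prod_pow_eq_pow_sum, Fin.prod_univ_three, Fin.prod_univ_three]
  exact Submodule.mul_mem_mul (Submodule.mul_mem_mul (Submodule.pow_mem_pow _ (hX 0) _)
    (Submodule.pow_mem_pow _ (hX 1) _)) (Submodule.pow_mem_pow _ (hX 2) _)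

lemma evalP_add (x : E3) (p q : MvPolynomial (Fin 3) ℝ) :
    evalP x (p + q) = evalP x p + evalP x q := by simp [evalP]

lemma evalP_mul (x : E3) (p q : MvPolynomial (Fin 3) ℝ) :
    evalP x (p * q) = evalP x p * evalP x q := by simp [evalP]

lemma continuous_evalP (p : MvPolynomial (Fin 3) ℝ) : Continuous fun x : E3 => evalP x p := by
  unfold evalP
  exact (MvPolynomial.continuous_eval p).comp (by fun_prop)

lemma evalP_affine (q : MvPolynomial (Fin 3) ℝ) (hq : q.totalDegree ≤ 1) :
    ∃ (c : ℝ) (l : E3 →ₗ[ℝ] ℝ), ∀ x, evalP x q = c + l x := by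
  have h := mem_pow_of_totalDegree (Submodule.span ℝ (insert 1 (Set.range X)))
    (Submodule.subset_span (Set.mem_insert _ _))
    (fun i => Submodule.subset_span (Set.mem_insert_of_mem _ ⟨i, rfl⟩)) 1 q hq
  rw [pow_one] at h
  clear hq
  induction h using Submodule.span_induction with
  | mem x h =>
    rcases h with rfl | ⟨i, rfl⟩
    · exact ⟨1, 0, fun x => by simp [evalP]⟩
    · exact ⟨0, (EuclideanSpace.proj i : E3 →L[ℝ] ℝ).toLinearMap, fun x => by simp [evalP]⟩
  | zero => exact ⟨0, 0, fun x => by simp [evalP]⟩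
  | add x y _ _ hx hy =>
    obtain ⟨c, l, h⟩ := hx
    obtain ⟨d, m, hp⟩ := hy
    exact ⟨c + d, l + m, fun z => by rw [evalP_add, h, hp]; simp; ring⟩
  | smul r x _ hx =>
    obtain ⟨c, l, h⟩ := hx
    refine ⟨r * c, r • l, fun z => ?_⟩
    have : evalP z (r • x) = r * evalP z x := by simp [evalP, smul_eval]
    rw [this, h]; simp; ring

/-! ### Parametrisations -/

def L2 (b : Fin 3 → E3) : ℝ × ℝ →L[ℝ] E3 :=
  (ContinuousLinearMap.fst ℝ ℝ ℝ).smulRight (b 1 - b 0) +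
    (ContinuousLinearMap.snd ℝ ℝ ℝ).smulRight (b 2 - b 0)

def L3 (a : Fin 4 → E3) : ℝ × ℝ × ℝ →L[ℝ] E3 :=
  (ContinuousLinearMap.fst ℝ ℝ (ℝ × ℝ)).smulRight (a 1 - a 0) +
    (L2 ![a 0, a 2, a 3]).comp (ContinuousLinearMap.snd ℝ ℝ (ℝ × ℝ))

lemma L2_apply (b : Fin 3 → E3) (p : ℝ × ℝ) :
    L2 b p = p.1 • (b 1 - b 0) + p.2 • (b 2 - b 0) := by simp [L2]

lemma L3_apply (b : Fin 4 → E3) (p : ℝ × ℝ × ℝ) :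
    L3 b p = p.1 • (b 1 - b 0) + p.2.1 • (b 2 - b 0) + p.2.2 • (b 3 - b 0) := by
  simp [L3, L2, add_assoc]

lemma convexHull_eq2 (b : Fin 3 → E3) :
    convexHull ℝ (Set.range b) = (fun p => b 0 + L2 b p) '' K2 1 := by
  apply subset_antisymm
  · apply convexHull_min
    · rintro _ ⟨i, rfl⟩
      fin_cases i
      · exact ⟨(0, 0), by simp [K2], by simp [L2_apply]⟩
      · exact ⟨(1, 0), by simp [K2], by simp [L2_apply]⟩
      · exact ⟨(0, 1), by simp [K2], by simp [L2_apply]⟩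
    · have hK : Convex ℝ (K2 1) := by
        rintro ⟨x1, x2⟩ ⟨h1, h2, h3⟩ ⟨y1, y2⟩ ⟨h4, h5, h6⟩ s t hs ht hst
        simp only at h1 h2 h3 h4 h5 h6
        refine ⟨?_, ?_, ?_⟩ <;> simp <;> try positivity
        nlinarith
      have := (hK.linear_image (L2 b).toLinearMap).translate (b 0)
      rw [Set.image_image] at this
      exact this
  · rintro _ ⟨⟨s, t⟩, ⟨h1, h2, h3⟩, rfl⟩
    simp only at h1 h2 h3
    have := (convex_convexHull ℝ (Set.range b)).sum_mem (t := Finset.univ)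
      (w := ![1 - s - t, s, t]) (z := b) (by
        intro i _; fin_cases i <;> simp <;> linarith) (by simp [Fin.sum_univ_succ])
      (fun i _ => subset_convexHull ℝ _ ⟨i, rfl⟩)
    convert! this using 1
    simp [Fin.sum_univ_three, L2_apply]
    module

lemma convexHull_eq3 (b : Fin 4 → E3) :
    convexHull ℝ (Set.range b) = (fun p => b 0 + L3 b p) '' K3 := by
  apply subset_antisymm
  · apply convexHull_min
    · rintro _ ⟨i, rfl⟩
      fin_cases i
      · exact ⟨(0, 0, 0), by simp [K3], by simp [L3_apply]⟩
      · exact ⟨(1, 0, 0), by simp [K3], by simp [L3_apply]⟩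
      · exact ⟨(0, 1, 0), by simp [K3], by simp [L3_apply]⟩
      · exact ⟨(0, 0, 1), by simp [K3], by simp [L3_apply]⟩
    · have hK : Convex ℝ K3 := by
        rintro ⟨x1, x2, x3⟩ ⟨h1, h2, h3, h3p⟩ ⟨y1, y2, y3⟩ ⟨h4, h5, h6, h6p⟩ s t hs ht hst
        simp only at h1 h2 h3 h3p h4 h5 h6 h6p
        refine ⟨?_, ?_, ?_, ?_⟩ <;> simp <;> try positivity
        nlinarith
      have := (hK.linear_image (L3 b).toLinearMap).translate (b 0)
      rw [Set.image_image] at this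
      exact this
  · rintro _ ⟨⟨q, s, t⟩, ⟨h1, h2, h3, h4⟩, rfl⟩
    simp only at h1 h2 h3 h4
    have := (convex_convexHull ℝ (Set.range b)).sum_mem (t := Finset.univ)
      (w := ![1 - q - s - t, q, s, t]) (z := b) (by
        intro i _; fin_cases i <;> simp <;> linarith) (by simp [Fin.sum_univ_succ]; ring)
      (fun i _ => subset_convexHull ℝ _ ⟨i, rfl⟩)
    convert! this using 1
    simp [Fin.sum_univ_four, L3_apply]
    module

lemma face_eq (a : Fin 4 → E3) (i : Fin 4) :
    face a i = convexHull ℝ (Set.range fun k => a (i.succAbove k)) := by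
  unfold face
  congr 1
  have : {j | j ≠ i} = Set.range i.succAbove := by rw [Fin.range_succAbove]; rfl
  rw [this, ← Set.range_comp]
  rfl

lemma evalP_L2 (b : Fin 3 → E3) (q : MvPolynomial (Fin 3) ℝ) (hq : q.totalDegree ≤ 1)
    (p : ℝ × ℝ) : evalP (b 0 + L2 b p) q =
      (1 - p.1 - p.2) * evalP (b 0) q + p.1 * evalP (b 1) q + p.2 * evalP (b 2) q := by
  obtain ⟨c, l, h⟩ := evalP_affine q hq
  simp [h, L2_apply]
  ring

lemma evalP_L3 (b : Fin 4 → E3) (q : MvPolynomial (Fin 3) ℝ) (hq : q.totalDegree ≤ 1)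
    (p : ℝ × ℝ × ℝ) : evalP (b 0 + L3 b p) q =
      (1 - p.1 - p.2.1 - p.2.2) * evalP (b 0) q + p.1 * evalP (b 1) q + p.2.1 * evalP (b 2) q
        + p.2.2 * evalP (b 3) q := by
  obtain ⟨c, l, h⟩ := evalP_affine q hq
  simp [h, L3_apply]
  ring

section main

variable (a : Fin 4 → E3) (lam : Fin 4 → MvPolynomial (Fin 3) ℝ)

/-- pulled-back face functional -/
def JF (i : Fin 4) (f : MvPolynomial (Fin 3) ℝ) : ℝ :=
  ∫ p in K2 1, evalP (a (i.succAbove 0) + L2 (fun k => a (i.succAbove k)) p) f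

def JT (f : MvPolynomial (Fin 3) ℝ) : ℝ := ∫ p in K3, evalP (a 0 + L3 a p) f

/-- barycentric monomials -/
def mon (n : Fin 4 → ℕ) : MvPolynomial (Fin 3) ℝ := ∏ j, lam j ^ n j

lemma JF_sum (i : Fin 4) (c : Fin 13 → ℝ) (f : Fin 13 → MvPolynomial (Fin 3) ℝ) :
    JF a i (∑ k, c k • f k) = ∑ k, c k * JF a i (f k) := by
  unfold JF
  simp_rw [← integral_const_mul]
  rw [← integral_finsetSum]
  · congr 1
    ext p
    simp [evalP, smul_eval]
  · intro k _
    apply ContinuousOn.integrableOn_compact (isCompact_K2 1)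
    apply Continuous.continuousOn
    apply Continuous.mul continuous_const
    exact (continuous_evalP _).comp (by fun_prop)

lemma JT_sum (c : Fin 13 → ℝ) (f : Fin 13 → MvPolynomial (Fin 3) ℝ) :
    JT a (∑ k, c k • f k) = ∑ k, c k * JT a (f k) := by
  unfold JT
  simp_rw [← integral_const_mul]
  rw [← integral_finsetSum]
  · congr 1
    ext p
    simp [evalP, smul_eval]
  · intro k _
    apply ContinuousOn.integrableOn_compact isCompact_K3
    apply Continuous.continuousOn
    apply Continuous.mul continuous_const
    exact (continuous_evalP _).comp (by fun_prop)

lemma evalP_mon (x : E3) (n : Fin 4 → ℕ) : evalP x (mon lam n) = ∏ j, evalP x (lam j) ^ n j := by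
  simp [evalP, mon]


lemma JF_mon
    (hdeg : ∀ i, (lam i).totalDegree ≤ 1)
    (hval : ∀ i j, evalP (a j) (lam i) = if i = j then 1 else 0) (i : Fin 4) (n : Fin 4 → ℕ) : JF a i (mon lam n) =
    0 ^ n i * ((n (i.succAbove 0)).factorial * (n (i.succAbove 1)).factorial *
      (n (i.succAbove 2)).factorial / (n (i.succAbove 0) + n (i.succAbove 1) +
        n (i.succAbove 2) + 2).factorial) := by
  have h : ∀ p : ℝ × ℝ, evalP (a (i.succAbove 0) + L2 (fun k => a (i.succAbove k)) p) (mon lam n)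
      = 0 ^ n i * ((1 - p.1 - p.2) ^ n (i.succAbove 0) * p.1 ^ n (i.succAbove 1) *
        p.2 ^ n (i.succAbove 2)) := by
    intro p
    rw [evalP_mon, Fin.prod_univ_succAbove _ i, Fin.prod_univ_three]
    have hv := fun j => evalP_L2 (fun k => a (i.succAbove k)) (lam j) (hdeg j) p
    simp only [hv, hval]
    simp [Fin.ne_succAbove]
  unfold JF
  simp_rw [h]
  rw [integral_const_mul, integral_K2 1 zero_le_one _ (by fun_prop)]
  congr 1
  have := dir2 1 (n (i.succAbove 0)) (n (i.succAbove 1)) (n (i.succAbove 2))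
  rw [one_pow, mul_one] at this
  exact this

lemma JT_mon
    (hdeg : ∀ i, (lam i).totalDegree ≤ 1)
    (hval : ∀ i j, evalP (a j) (lam i) = if i = j then 1 else 0) (n : Fin 4 → ℕ) : JT a (mon lam n) =
    ((n 0).factorial * (n 1).factorial * (n 2).factorial * (n 3).factorial /
      (n 0 + n 1 + n 2 + n 3 + 3).factorial) := by
  have h : ∀ p : ℝ × ℝ × ℝ, evalP (a 0 + L3 a p) (mon lam n)
      = (1 - p.1 - p.2.1 - p.2.2) ^ n 0 * p.1 ^ n 1 * p.2.1 ^ n 2 * p.2.2 ^ n 3 := by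
    intro p
    rw [evalP_mon, Fin.prod_univ_four]
    have hv := fun j => evalP_L3 a (lam j) (hdeg j) p
    simp only [hv, hval]
    simp
  unfold JT
  simp_rw [h]
  rw [integral_K3 _ (by fun_prop)]
  have := dir3 1 (n 0) (n 1) (n 2) (n 3)
  rw [one_pow, mul_one] at this
  exact this

lemma L2_inj
    (hdeg : ∀ i, (lam i).totalDegree ≤ 1)
    (hval : ∀ i j, evalP (a j) (lam i) = if i = j then 1 else 0) (i : Fin 4) : Function.Injective (L2 (fun k => a (i.succAbove k))) := by
  intro p q hpq
  have hv := fun j => evalP_L2 (fun k => a (i.succAbove k)) (lam j) (hdeg j)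
  have h1 := hv (i.succAbove 1) p
  have h2 := hv (i.succAbove 2) p
  rw [hpq, hv] at h1 h2
  simp [hval] at h1 h2
  exact Prod.ext h1.symm h2.symm

lemma L3_inj
    (hdeg : ∀ i, (lam i).totalDegree ≤ 1)
    (hval : ∀ i j, evalP (a j) (lam i) = if i = j then 1 else 0) : Function.Injective (L3 a) := by
  intro p q hpq
  have hv := fun j => evalP_L3 a (lam j) (hdeg j)
  have h1 := hv 1 p
  have h2 := hv 2 p
  have h3 := hv 3 p
  rw [hpq, hv] at h1 h2 h3
  simp [hval] at h1 h2 h3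
  exact Prod.ext h1.symm (Prod.ext h2.symm h3.symm)

lemma L3_surj
    (hdeg : ∀ i, (lam i).totalDegree ≤ 1)
    (hval : ∀ i j, evalP (a j) (lam i) = if i = j then 1 else 0) : Function.Surjective (L3 a) :=
  (LinearMap.injective_iff_surjective_of_finrank_eq_finrank (f := (L3 a).toLinearMap)
    (by simp)).1 (L3_inj a lam hdeg hval)

lemma face_int
    (hdeg : ∀ i, (lam i).totalDegree ≤ 1)
    (hval : ∀ i j, evalP (a j) (lam i) = if i = j then 1 else 0) (i : Fin 4) : ∃ C : ℝ, C ≠ 0 ∧ ∀ f : MvPolynomial (Fin 3) ℝ,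
    ∫ x in face a i, evalP x f ∂(μH[2]) = C * JF a i f := by
  have hinj := L2_inj a lam hdeg hval i
  set L := L2 (fun k => a (i.succAbove k)) with hL
  obtain ⟨C, hC, h⟩ := integral_affine L hinj μH[2] (by
    intro K hK
    refine lt_of_le_of_lt (L.lipschitz.hausdorffMeasure_image_le (by norm_num) K) ?_
    rw [hausdorffMeasure_prod_real]
    exact ENNReal.mul_lt_top (by simp) hK.measure_lt_top) (by
    intro h0
    obtain ⟨K, hK, hanti⟩ := (L : ℝ × ℝ →ₗ[ℝ] E3).exists_antilipschitzWith
      (LinearMap.ker_eq_bot.2 hinj)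
    have := hanti.le_hausdorffMeasure_image (d := 2) (by norm_num) Set.univ
    have h0p : μH[2] ((L : ℝ × ℝ →ₗ[ℝ] E3) '' Set.univ) = 0 := h0
    rw [hausdorffMeasure_prod_real, h0p, mul_zero] at this
    simp at this)
  refine ⟨C, hC, fun f => ?_⟩
  rw [face_eq, convexHull_eq2, h]
  rfl

lemma tetra_int
    (hdeg : ∀ i, (lam i).totalDegree ≤ 1)
    (hval : ∀ i j, evalP (a j) (lam i) = if i = j then 1 else 0) : ∃ C : ℝ, C ≠ 0 ∧ ∀ f : MvPolynomial (Fin 3) ℝ,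
    ∫ x in tetra a, evalP x f = C * JT a f := by
  have hH2 : (volume : Measure (ℝ × ℝ)).IsAddHaarMeasure := by
    rw [Measure.volume_eq_prod]; infer_instance
  have hH3 : (volume : Measure (ℝ × ℝ × ℝ)).IsAddHaarMeasure := by
    rw [Measure.volume_eq_prod]; infer_instance
  obtain ⟨C, hC, h⟩ := integral_affine (L3 a) (L3_inj a lam hdeg hval) volume (by
    intro K hK
    exact (hK.image (L3 a).continuous).measure_lt_top) (by
    rw [Set.image_univ_of_surjective (L3_surj a lam hdeg hval)]
    simp)
  refine ⟨C, hC, fun f => ?_⟩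
  rw [tetra, convexHull_eq3, h]
  rfl

lemma zero_of_vanish
    (hdeg : ∀ i, (lam i).totalDegree ≤ 1)
    (hval : ∀ i j, evalP (a j) (lam i) = if i = j then 1 else 0) (q : MvPolynomial (Fin 3) ℝ) (hq : q.totalDegree ≤ 1)
    (h : ∀ j, evalP (a j) q = 0) : q = 0 := by
  apply MvPolynomial.funext
  intro x
  obtain ⟨p, hp⟩ := L3_surj a lam hdeg hval (WithLp.toLp 2 x - a 0)
  have := evalP_L3 a q hq p
  rw [hp, h, h, h, h] at this
  simpa [evalP] using this

lemma lam_sum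
    (hdeg : ∀ i, (lam i).totalDegree ≤ 1)
    (hval : ∀ i j, evalP (a j) (lam i) = if i = j then 1 else 0) : ∑ j, lam j = 1 := by
  rw [← sub_eq_zero]
  apply zero_of_vanish a lam hdeg hval
  · refine (totalDegree_sub _ _).trans (max_le ?_ (by simp))
    exact totalDegree_finsetSum_le fun i _ => hdeg i
  · intro j
    have : evalP (a j) (∑ j, lam j - 1) = ∑ i, evalP (a j) (lam i) - 1 := by simp [evalP]
    rw [this]
    simp [hval]

lemma lam_X
    (hdeg : ∀ i, (lam i).totalDegree ≤ 1)
    (hval : ∀ i j, evalP (a j) (lam i) = if i = j then 1 else 0) (k : Fin 3) : ∑ j, a j k • lam j = X k := by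
  rw [← sub_eq_zero]
  apply zero_of_vanish a lam hdeg hval
  · refine (totalDegree_sub _ _).trans (max_le ?_ (by simp))
    exact totalDegree_finsetSum_le fun i _ => (totalDegree_smul_le _ _).trans (hdeg i)
  · intro j
    have : evalP (a j) (∑ j, a j k • lam j - X k) = ∑ i, a i k * evalP (a j) (lam i) - a j k := by
      simp [evalP, smul_eval]
    rw [this]
    simp [hval]


/-- exponents of the thirteen basis elements -/
def bexp : Fin 13 → Fin 4 → ℕ :=
  ![![2, 0, 0, 0], ![0, 2, 0, 0], ![0, 0, 2, 0], ![0, 0, 0, 2],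
    ![1, 1, 0, 0], ![1, 0, 1, 0], ![1, 0, 0, 1], ![0, 1, 1, 0], ![0, 1, 0, 1], ![0, 0, 1, 1],
    ![2, 1, 0, 0], ![0, 2, 1, 0], ![1, 0, 2, 0]]

lemma mon_mul (n : Fin 4 → ℕ) (j : Fin 4) : mon lam n * lam j = mon lam (n + Pi.single j 1) := by
  simp only [mon, Pi.add_apply, pow_add, Finset.prod_mul_distrib]
  congr 1
  rw [Finset.prod_eq_single j] <;> simp +contextual

lemma mon_mem (k : Fin 13) : mon lam (bexp k) ∈
    Submodule.span ℝ (Set.range fun k => mon lam (bexp k)) := Submodule.subset_span ⟨k, rfl⟩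

lemma mon10 : mon lam (bexp 10) = lam 0 ^ 2 * lam 1 := by
  simp [mon, bexp, Fin.prod_univ_four]

lemma mon11 : mon lam (bexp 11) = lam 1 ^ 2 * lam 2 := by
  simp [mon, bexp, Fin.prod_univ_four]

lemma mon12 : mon lam (bexp 12) = lam 2 ^ 2 * lam 0 := by
  simp [mon, bexp, Fin.prod_univ_four]
  ring

lemma quad_mem (i j : Fin 4) : lam i * lam j ∈
    Submodule.span ℝ (Set.range fun k => mon lam (bexp k)) := by
  have h : ∀ i j : Fin 4, ∃ k, bexp k = Pi.single i 1 + Pi.single j 1 := by decide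
  obtain ⟨k, hk⟩ := h i j
  have := mon_mem lam k
  rw [hk, ← mon_mul] at this
  have h1 : mon lam (Pi.single i 1) = lam i := by
    have := mon_mul lam 0 i
    simpa [mon] using this.symm
  rwa [h1] at this


lemma P3_eq
    (hdeg : ∀ i, (lam i).totalDegree ≤ 1)
    (hval : ∀ i j, evalP (a j) (lam i) = if i = j then 1 else 0) : P3minus lam = (Submodule.span ℝ (Set.range fun k => mon lam (bexp k)) :
    Set (MvPolynomial (Fin 3) ℝ)) := by
  apply subset_antisymm
  · rintro _ ⟨p, c1, c2, c3, hp, rfl⟩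
    have hV := mem_pow_of_totalDegree (Submodule.span ℝ (Set.range lam)) (by
      rw [← lam_sum a lam hdeg hval]
      exact Submodule.sum_mem _ fun i _ => Submodule.subset_span ⟨i, rfl⟩) (by
      intro k
      rw [← lam_X a lam hdeg hval]
      exact Submodule.sum_mem _ fun i _ => Submodule.smul_mem _ _ (Submodule.subset_span ⟨i, rfl⟩))
      2 p hp
    rw [pow_two, Submodule.span_mul_span] at hV
    refine add_mem (add_mem (add_mem ?_ (Submodule.smul_mem _ _ ?_))
      (Submodule.smul_mem _ _ ?_)) (Submodule.smul_mem _ _ ?_)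
    · refine Submodule.span_le.2 ?_ hV
      rintro _ ⟨_, ⟨i, rfl⟩, _, ⟨j, rfl⟩, rfl⟩
      exact quad_mem lam i j
    · rw [← mon10]
      exact mon_mem lam 10
    · rw [← mon11]
      exact mon_mem lam 11
    · rw [← mon12]
      exact mon_mem lam 12
  · intro w hw
    obtain ⟨c, rfl⟩ := (Submodule.mem_span_range_iff_exists_fun ℝ).1 hw
    refine ⟨∑ k : Fin 10, c (k.castLE (by norm_num)) •
      mon lam (bexp (k.castLE (by norm_num))), c 10, c 11, c 12, ?_, ?_⟩
    · refine totalDegree_finsetSum_le fun k _ => (totalDegree_smul_le _ _).trans ?_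
      have hk : ∀ k : Fin 10, ∑ j, bexp (k.castLE (by norm_num)) j = 2 := by decide
      rw [← hk k]
      refine (totalDegree_finsetProd _ _).trans (Finset.sum_le_sum fun j _ => ?_)
      refine (totalDegree_pow _ _).trans ?_
      nlinarith [hdeg j]
    · rw [← mon10, ← mon11, ← mon12]
      rw [Fin.sum_univ_castSucc, Fin.sum_univ_castSucc, Fin.sum_univ_castSucc]
      rfl

set_option maxHeartbeats 2000000 in
lemma coeff_zero
    (hdeg : ∀ i, (lam i).totalDegree ≤ 1)
    (hval : ∀ i j, evalP (a j) (lam i) = if i = j then 1 else 0) (c : Fin 13 → ℝ)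
    (hF : ∀ i j, JF a i ((∑ k, c k • mon lam (bexp k)) * lam j) = 0)
    (hT : JT a (∑ k, c k • mon lam (bexp k)) = 0) : c = 0 := by
  have hFp : ∀ i j, ∑ k, c k * JF a i (mon lam (bexp k + Pi.single j 1)) = 0 := by
    intro i j
    rw [← hF i j, Finset.sum_mul]
    simp only [smul_mul_assoc, mon_mul]
    rw [JF_sum]
  rw [JT_sum] at hT
  simp only [JF_mon a lam hdeg hval] at hFp
  simp only [JT_mon a lam hdeg hval] at hT
  have hs : ∀ m : Fin 13 → ℝ, ∑ k, m k = m 0 + m 1 + m 2 + m 3 + m 4 + m 5 + m 6 + m 7 + m 8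
      + m 9 + m 10 + m 11 + m 12 := by
    intro m
    simp only [Fin.sum_univ_succ, Fin.sum_univ_zero]
    simp [← add_assoc]
  have e01 := hFp 0 1
  have e02 := hFp 0 2
  have e03 := hFp 0 3
  have e10 := hFp 1 0
  have e12 := hFp 1 2
  have e13 := hFp 1 3
  have e20 := hFp 2 0
  have e21 := hFp 2 1
  have e23 := hFp 2 3
  have e30 := hFp 3 0
  have e31 := hFp 3 1
  have e32 := hFp 3 2
  clear hF hFp
  simp only [hs] at *
  simp [bexp, Fin.succAbove, Nat.factorial] at hT e01 e02 e03 e10 e12 e13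
  simp [bexp, Fin.succAbove, Nat.factorial] at e20 e21 e23 e30 e31 e32
  ext k
  fin_cases k <;> simp
  all_goals linarith

end main

/-- `dim P₃⁻(T) = 13`, and any element of `P₃⁻(T)` is uniquely
determined by the twelve first-order facet moments together with the mean over
the tetrahedron. -/
theorem stmt15 (a : Fin 4 → E3) (hind : AffineIndependent ℝ a)
    (lam : Fin 4 → MvPolynomial (Fin 3) ℝ)
    (hdeg : ∀ i, (lam i).totalDegree ≤ 1)
    (hval : ∀ i j, evalP (a j) (lam i) = if i = j then 1 else 0) :
    Set.finrank ℝ (P3minus lam) = 13 ∧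
    ∀ u ∈ P3minus lam, ∀ v ∈ P3minus lam,
      (∀ (i : Fin 4) (q : MvPolynomial (Fin 3) ℝ), q.totalDegree ≤ 1 →
        ∫ x in face a i, evalP x u * evalP x q ∂(μH[2])
          = ∫ x in face a i, evalP x v * evalP x q ∂(μH[2])) →
      (∫ x in tetra a, evalP x u) = (∫ x in tetra a, evalP x v) →
      u = v := by
  have hP := P3_eq a lam hdeg hval
  choose CF hCF hFint using fun i => face_int a lam hdeg hval i
  obtain ⟨CT, hCT, hTint⟩ := tetra_int a lam hdeg hval
  constructor
  · have hli : LinearIndependent ℝ (fun k => mon lam (bexp k)) := by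
      rw [Fintype.linearIndependent_iff]
      intro c hc
      have : c = 0 := by
        apply coeff_zero a lam hdeg hval c
        · intro i j
          rw [hc]
          simp [JF, evalP]
        · rw [hc]
          simp [JT, evalP]
      intro k
      rw [this]
      rfl
    rw [Set.finrank, hP, Submodule.span_eq, finrank_span_eq_card hli]
    simp
  · intro u hu v hv hF hT
    rw [hP] at hu hv
    obtain ⟨c, rfl⟩ := (Submodule.mem_span_range_iff_exists_fun ℝ).1 hu
    obtain ⟨d, rfl⟩ := (Submodule.mem_span_range_iff_exists_fun ℝ).1 hv
    have hcd : c - d = 0 := by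
      apply coeff_zero a lam hdeg hval
      · intro i j
        have h := hF i (lam j) (hdeg j)
        simp only [← evalP_mul, hFint] at h
        have h := mul_left_cancel₀ (hCF i) h
        simp only [Finset.sum_mul, smul_mul_assoc, JF_sum] at h ⊢
        simp only [Pi.sub_apply, sub_mul, Finset.sum_sub_distrib]
        rw [h, sub_self]
      · rw [hTint, hTint] at hT
        have h := mul_left_cancel₀ hCT hT
        simp only [JT_sum] at h ⊢
        simp only [Pi.sub_apply, sub_mul, Finset.sum_sub_distrib]
        rw [h, sub_self]
    rw [sub_eq_zero.1 hcd]
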